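/- Let X_free ⊆ ℝ², let σ_s be a path in X_free of finite cost, and let σ* be a path in X_free of finite cost with σ*(0) = σ_s(1) that is parametrized proportionally to arc length (c(σ*_{[0,t]}) = t·c(σ*) for all t ∈ [0,1]). Define g(t) := m[σ_s * σ*_{[0,t]}] for t ∈ [0,1]. Then for all t, t′ ∈ [0,1], |g(t) − g(t′)| ≤ |t − t′|·c(σ*); in particular g is continuous on [0,1]. -/

import Mathlib

noncomputable section

/-- Points of the plane. -/
abbrev E2 : Type := EuclideanSpace ℝ (Fin 2)

namespace THPP

lemma subIcc_mem (s t₁ t₂ : unitInterval) :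
    (1 - s.1) * t₁.1 + s.1 * t₂.1 ∈ Set.Icc (0 : ℝ) 1 := by
  have hs0 : (0:ℝ) ≤ s.1 := s.2.1
  have hs1 : s.1 ≤ 1 := s.2.2
  have ha0 : (0:ℝ) ≤ t₁.1 := t₁.2.1
  have ha1 : t₁.1 ≤ 1 := t₁.2.2
  have hb0 : (0:ℝ) ≤ t₂.1 := t₂.2.1
  have hb1 : t₂.1 ≤ 1 := t₂.2.2
  constructor
  · have h1 := mul_nonneg (by linarith : (0:ℝ) ≤ 1 - s.1) ha0
    have h2 := mul_nonneg hs0 hb0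
    linarith
  · have h1 := mul_nonneg (by linarith : (0:ℝ) ≤ 1 - s.1) (by linarith : (0:ℝ) ≤ 1 - t₁.1)
    have h2 := mul_nonneg hs0 (by linarith : (0:ℝ) ≤ 1 - t₂.1)
    nlinarith

/-- The subpath `σ_{[t₁,t₂]} : s ↦ σ ((1-s)·t₁ + s·t₂)`. -/
def subpath {Y : Type*} [TopologicalSpace Y] {a b : Y} (σ : Path a b) (t₁ t₂ : unitInterval) :
    Path (σ t₁) (σ t₂) where
  toFun s := σ ⟨(1 - s.1) * t₁.1 + s.1 * t₂.1, subIcc_mem s t₁ t₂⟩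
  continuous_toFun := σ.continuous.comp (Continuous.subtype_mk (by fun_prop) _)
  source' := by
    exact congrArg (fun u => σ u) (Subtype.ext (by simp))
  target' := by
    exact congrArg (fun u => σ u) (Subtype.ext (by simp))

/-- The subpath `σ_{[0,t]}`, as a path from the start point of `σ` to `σ t`. -/
def subpath0 {Y : Type*} [TopologicalSpace Y] {a b : Y} (σ : Path a b) (t : unitInterval) :
    Path a (σ t) :=
  (subpath σ 0 t).cast σ.source.symm rfl

/-- The straight-line path `t ↦ (1-t)·x₀ + t·x₁`, as a path in `X` given that the
segment `[x₀, x₁]` is contained in `X`. -/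
def linePath {X : Set E2} {x₀ x₁ : E2} (h₀ : x₀ ∈ X) (h₁ : x₁ ∈ X)
    (hseg : segment ℝ x₀ x₁ ⊆ X) : Path (⟨x₀, h₀⟩ : X) ⟨x₁, h₁⟩ where
  toFun t := ⟨(1 - t.1) • x₀ + t.1 • x₁,
    hseg (by rw [segment_eq_image]; exact ⟨t.1, t.2, rfl⟩)⟩
  continuous_toFun := Continuous.subtype_mk (by fun_prop) _
  source' := Subtype.ext (by simp)
  target' := Subtype.ext (by simp)

/-- The cost (arc length) of a path in a subset of the plane: the total variation of the
underlying map `[0,1] → ℝ²`. -/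
def cost {X : Set E2} {a b : X} (σ : Path a b) : ENNReal :=
  eVariationOn (fun t => (σ t : E2)) Set.univ

/-- A path is an optimal homotopic path if it has minimal cost within its
path-homotopy class (homotopies staying in `X`). -/
def IsOptimal {X : Set E2} {a b : X} (σ : Path a b) : Prop :=
  ∀ σ' : Path a b, σ.Homotopic σ' → cost σ ≤ cost σ'

/-- `m[σ]`: the infimal cost of the path-homotopy class of `σ`. -/
def mCost {X : Set E2} {a b : X} (σ : Path a b) : ENNReal :=
  ⨅ σ' : {σ' : Path a b // σ.Homotopic σ'}, cost σ'.1

/-- Concatenation `σ₀ * σ₁ * ⋯ * σ_{n-1}` of a chain of paths. -/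
def chain {Y : Type*} [TopologicalSpace Y] (x : ℕ → Y)
    (σ : ∀ i : ℕ, Path (x i) (x (i + 1))) : ∀ n : ℕ, Path (x 0) (x n)
  | 0 => Path.refl (x 0)
  | n + 1 => (chain x σ n).trans (σ n)



lemma cost_trans_le {X : Set E2} {a b c : X} (p : Path a b) (q : Path b c) :
    cost (p.trans q) ≤ cost p + cost q := by
  have hh : (1 / 2 : ℝ) ∈ Set.Icc (0 : ℝ) 1 := by constructor <;> norm_num
  let h : unitInterval := ⟨1 / 2, hh⟩
  have hu : (Set.univ : Set unitInterval) = Set.Iic h ∪ Set.Ici h := Set.Iic_union_Ici.symm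
  unfold cost
  rw [hu, eVariationOn.union _ (x := h) isGreatest_Iic isLeast_Ici, ← hu]
  gcongr
  · have he : Set.EqOn (fun t => ((p.trans q) t : E2))
        ((fun t => (p t : E2)) ∘ fun t : unitInterval =>
          Set.projIcc (0 : ℝ) 1 zero_le_one (2 * t.1)) (Set.Iic h) := by
      intro t ht
      have ht' : t.1 ≤ 1 / 2 := ht
      have hm : 2 * t.1 ∈ Set.Icc (0 : ℝ) 1 := ⟨by linarith [t.2.1], by linarith⟩
      simp only [Function.comp]
      rw [Path.trans_apply, dif_pos ht', Set.projIcc_of_mem _ hm]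
    rw [eVariationOn.eq_of_eqOn he]
    refine eVariationOn.comp_le_of_monotoneOn _ _ ?_ (Set.mapsTo_univ _ _)
    intro x _ y _ hxy
    apply Set.monotone_projIcc
    have : x.1 ≤ y.1 := hxy
    linarith
  · have he : Set.EqOn (fun t => ((p.trans q) t : E2))
        ((fun t => (q t : E2)) ∘ fun t : unitInterval =>
          Set.projIcc (0 : ℝ) 1 zero_le_one (2 * t.1 - 1)) (Set.Ici h) := by
      intro t ht
      have ht' : 1 / 2 ≤ t.1 := ht
      have hm : 2 * t.1 - 1 ∈ Set.Icc (0 : ℝ) 1 := ⟨by linarith, by linarith [t.2.2]⟩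
      simp only [Function.comp]
      rw [Path.trans_apply, Set.projIcc_of_mem _ hm]
      split_ifs with h1
      · have h2 : t.1 = 1 / 2 := le_antisymm h1 ht'
        have e1 : (⟨2 * t.1, (unitInterval.mul_pos_mem_iff zero_lt_two).2 ⟨t.2.1, h1⟩⟩ :
          unitInterval) = 1 := Subtype.ext (by simp [h2])
        have e2 : (⟨2 * t.1 - 1, hm⟩ : unitInterval) = 0 := Subtype.ext (by simp [h2])
        rw [e1, e2, p.target, q.source]
      · rfl
    rw [eVariationOn.eq_of_eqOn he]
    refine eVariationOn.comp_le_of_monotoneOn _ _ ?_ (Set.mapsTo_univ _ _)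
    intro x _ y _ hxy
    apply Set.monotone_projIcc
    have : x.1 ≤ y.1 := hxy
    linarith

lemma subpath_eq {Y : Type*} [TopologicalSpace Y] {a b : Y} (σ : Path a b)
    (t₁ t₂ : unitInterval) : subpath σ t₁ t₂ = σ.subpath t₁ t₂ := rfl

lemma cost_subpath {X : Set E2} {a b : X} (σ : Path a b) (t₁ t₂ : unitInterval) :
    cost (subpath σ t₁ t₂) = eVariationOn (fun t => (σ t : E2)) (Set.uIcc t₁ t₂) := by
  rw [← Path.range_subpathAux, ← Set.image_univ]
  rcases le_total t₁ t₂ with h | h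
  · rw [← eVariationOn.comp_eq_of_monotoneOn]
    · rfl
    · intro x _ y _ hxy
      have h1 : x.1 ≤ y.1 := hxy
      have h2 : t₁.1 ≤ t₂.1 := h
      show (1 - x.1) * t₁.1 + x.1 * t₂.1 ≤ (1 - y.1) * t₁.1 + y.1 * t₂.1
      nlinarith
  · rw [← eVariationOn.comp_eq_of_antitoneOn]
    · rfl
    · intro x _ y _ hxy
      have h1 : x.1 ≤ y.1 := hxy
      have h2 : t₂.1 ≤ t₁.1 := h
      show (1 - y.1) * t₁.1 + y.1 * t₂.1 ≤ (1 - x.1) * t₁.1 + x.1 * t₂.1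
      nlinarith

lemma cost_subpath0 {X : Set E2} {a b : X} (σ : Path a b) (t : unitInterval) :
    cost (subpath0 σ t) = eVariationOn (fun t => (σ t : E2)) (Set.Icc 0 t) := by
  rw [← Set.uIcc_of_le (unitInterval.nonneg' : 0 ≤ t), ← cost_subpath]
  rfl

lemma var_Icc {X : Set E2} {a b : X} (σ : Path a b) (hf : cost σ ≠ ⊤)
    (hparam : ∀ t : unitInterval, cost (subpath0 σ t) = ENNReal.ofReal t.1 * cost σ)
    (t t' : unitInterval) (h : t ≤ t') :
    eVariationOn (fun t => (σ t : E2)) (Set.Icc t t') = ENNReal.ofReal (t'.1 - t.1) * cost σ := by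
  have h1 := eVariationOn.Icc_add_Icc (fun t => (σ t : E2)) (s := Set.univ)
    (unitInterval.nonneg' : 0 ≤ t) h (Set.mem_univ _)
  simp only [Set.univ_inter] at h1
  rw [← cost_subpath0, ← cost_subpath0, hparam, hparam] at h1
  have hne : ENNReal.ofReal t.1 * cost σ ≠ ⊤ := ENNReal.mul_ne_top ENNReal.ofReal_ne_top hf
  have h2 : t.1 ≤ t'.1 := h
  have h3 : ENNReal.ofReal t'.1 = ENNReal.ofReal t.1 + ENNReal.ofReal (t'.1 - t.1) := by
    rw [← ENNReal.ofReal_add t.2.1 (by linarith)]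
    congr 1; ring
  rw [h3, add_mul] at h1
  exact (ENNReal.add_right_inj hne).1 h1

lemma cost_subpath_param {X : Set E2} {a b : X} (σ : Path a b) (hf : cost σ ≠ ⊤)
    (hparam : ∀ t : unitInterval, cost (subpath0 σ t) = ENNReal.ofReal t.1 * cost σ)
    (t t' : unitInterval) :
    cost (subpath σ t t') = ENNReal.ofReal |t.1 - t'.1| * cost σ := by
  rw [cost_subpath]
  rcases le_total t t' with h | h
  · have h2 : t.1 ≤ t'.1 := h
    rw [Set.uIcc_of_le h, var_Icc σ hf hparam t t' h, abs_sub_comm,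
      abs_of_nonneg (sub_nonneg.2 h2)]
  · have h2 : t'.1 ≤ t.1 := h
    rw [Set.uIcc_of_ge h, var_Icc σ hf hparam t' t h, abs_of_nonneg (sub_nonneg.2 h2)]

lemma subpath0_homotopic {Y : Type*} [TopologicalSpace Y] {a b : Y} (σ : Path a b)
    (t t' : unitInterval) :
    ((subpath0 σ t).trans (subpath σ t t')).Homotopic (subpath0 σ t') := by
  have H := Path.Homotopy.subpathTransSubpath σ 0 t t'
  exact ⟨(H.pathCast σ.source.symm rfl).cast rfl rfl⟩

lemma mCost_step {X : Set E2} {a b c : X} (σs : Path a b) (σ : Path b c)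
    (t t' : unitInterval) :
    mCost (σs.trans (subpath0 σ t')) ≤
      mCost (σs.trans (subpath0 σ t)) + cost (subpath σ t t') := by
  unfold mCost
  rw [ENNReal.iInf_add]
  refine le_iInf fun p => ?_
  have h1 := Path.Homotopic.hcomp (Path.Homotopic.refl σs) (subpath0_homotopic σ t t')
  have h2 := Path.Homotopic.trans_assoc σs (subpath0 σ t) (subpath σ t t')
  have h3 := Path.Homotopic.hcomp p.2 (Path.Homotopic.refl (subpath σ t t'))
  have h4 : (σs.trans (subpath0 σ t')).Homotopic (p.1.trans (subpath σ t t')) :=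
    h1.symm.trans (h2.symm.trans h3)
  exact (iInf_le (fun σ' : {σ' : Path a (σ t') //
    (σs.trans (subpath0 σ t')).Homotopic σ'} => cost σ'.1) ⟨_, h4⟩).trans (cost_trans_le _ _)

/-- for `σ*` parametrized proportionally to arc length, the function
`g(t) = m[σ_s * σ*_{[0,t]}]` satisfies `|g(t) - g(t')| ≤ |t - t'|·c(σ*)`;
in particular `g` is continuous. -/
theorem mcost_general_lipschitz {X : Set E2} {xa xb xc : X}
    (σs : Path xa xb) (σstar : Path xb xc)
    (hfs : cost σs ≠ ⊤) (hfst : cost σstar ≠ ⊤)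
    (hparam : ∀ t : unitInterval,
      cost (subpath0 σstar t) = ENNReal.ofReal t.1 * cost σstar)
    (g : unitInterval → ℝ)
    (hg : ∀ t, g t = (mCost (σs.trans (subpath0 σstar t))).toReal) :
    (∀ t t' : unitInterval, |g t - g t'| ≤ |t.1 - t'.1| * (cost σstar).toReal) ∧
    Continuous g := by
  have hfin : ∀ t, mCost (σs.trans (subpath0 σstar t)) ≠ ⊤ := by
    intro t
    have h1 : mCost (σs.trans (subpath0 σstar t)) ≤ cost (σs.trans (subpath0 σstar t)) :=
      iInf_le (fun σ' : {σ' : Path xa (σstar t) //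
        (σs.trans (subpath0 σstar t)).Homotopic σ'} => cost σ'.1)
        ⟨_, Path.Homotopic.refl _⟩
    refine ne_top_of_le_ne_top ?_ (h1.trans (cost_trans_le _ _))
    rw [hparam]
    exact ENNReal.add_ne_top.2 ⟨hfs, ENNReal.mul_ne_top ENNReal.ofReal_ne_top hfst⟩
  have hstep : ∀ t t' : unitInterval,
      g t' ≤ g t + |t.1 - t'.1| * (cost σstar).toReal := by
    intro t t'
    have h := mCost_step σs σstar t t'
    rw [cost_subpath_param σstar hfst hparam] at h
    have hne : ENNReal.ofReal |t.1 - t'.1| * cost σstar ≠ ⊤ :=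
      ENNReal.mul_ne_top ENNReal.ofReal_ne_top hfst
    have h' := ENNReal.toReal_mono (ENNReal.add_ne_top.2 ⟨hfin t, hne⟩) h
    rw [ENNReal.toReal_add (hfin t) hne, ENNReal.toReal_mul,
      ENNReal.toReal_ofReal (abs_nonneg _)] at h'
    rw [hg, hg]
    exact h'
  have hlip : ∀ t t' : unitInterval,
      |g t - g t'| ≤ |t.1 - t'.1| * (cost σstar).toReal := by
    intro t t'
    have h1 := hstep t t'
    have h2 := hstep t' t
    rw [abs_sub_comm t'.1] at h2
    rw [abs_le]
    constructor <;> linarith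
  refine ⟨hlip, ?_⟩
  refine (LipschitzWith.of_dist_le_mul (K := (cost σstar).toNNReal) fun t t' => ?_).continuous
  have := hlip t t'
  rw [mul_comm] at this
  exact this

end THPP
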